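/- Under the expected growth condition and the lower-rate condition, suppose additionally there is a measurable f̄ : E → [0,∞) with f(y,a) ≤ f̄(y) for all y ∈ E, a ∈ 𝕌(y), and ∫_0^{t*(x)} e^{−∫_0^t λ̲(φ(x,s))ds} f̄(φ(x,t)) dt < ∞ for all x ∈ E. Let α ≥ 0, ρ ≥ 0 and h ∈ B_g(E). Then for every x ∈ E with t*(x) = ∞ and every relaxed control Θ = (μ,μ∂) ∈ V^r(x), the limit lim_{t→∞} ∫_0^t e^{−αs−Λ^μ(x,s)}·[−ρ + f(φ(x,s),μ(s)) + λQh(φ(x,s),μ(s))] ds exists in ℝ and equals −ρ·𝓛_α(x,Θ) + L_α f(x,Θ) + H_α r(x,Θ) + G_α h(x,Θ) (note H_α r(x,Θ) = 0 since t*(x) = ∞). -/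

import Mathlib

open MeasureTheory ENNReal Set Filter Topology

namespace PDMP

noncomputable section

/-- Data of a controlled PDMP: state space `E ⊆ ℝⁿ`, flow `φ`, feasible action sets `feas = 𝕌`,
jump rate `lam = λ` and transition kernel `Q`. -/
structure Setting (n : ℕ) (U : Type*) [MeasurableSpace U] where
  E : Set (Fin n → ℝ)
  φ : (Fin n → ℝ) → ℝ → (Fin n → ℝ)
  feas : (Fin n → ℝ) → Set U
  lam : (Fin n → ℝ) → U → ℝ
  Q : (Fin n → ℝ) → U → Measure (Fin n → ℝ)

/-- A relaxed control: a time component (measures on the action space along the flow) and a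
boundary component. -/
structure RControl (U : Type*) [MeasurableSpace U] where
  time : ℝ → Measure U
  bdry : Measure U

variable {n : ℕ} {U : Type*} [MeasurableSpace U]

namespace Setting

variable (S : Setting n U)

/-- The exit time `t*(x)` from `E`, valued in `[0,∞]` (`∞` if the flow never reaches `∂E`). -/
def ts (x : Fin n → ℝ) : ℝ≥0∞ :=
  sInf {T : ℝ≥0∞ | ∃ t : ℝ, 0 < t ∧ S.φ x t ∈ frontier S.E ∧ T = ENNReal.ofReal t}

/-- Real version of the exit time (junk value `0` when `t*(x) = ∞`). -/
def tsR (x : Fin n → ℝ) : ℝ := (S.ts x).toReal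

/-- The time interval `[0, t*(x))` as a subset of `ℝ`. -/
def fs (x : Fin n → ℝ) : Set ℝ := {t : ℝ | 0 ≤ t ∧ ENNReal.ofReal t < S.ts x}

/-- `λ(y,μ) = ∫ λ(y,u) μ(du)`, as an extended nonnegative real. -/
def lamMix (y : Fin n → ℝ) (m : Measure U) : ℝ≥0∞ := ∫⁻ u, ENNReal.ofReal (S.lam y u) ∂m

/-- `Q k (y,a) = ∫_E k(z) Q(y,a;dz)`. -/
def Qpt (k : (Fin n → ℝ) → ℝ≥0∞) (y : Fin n → ℝ) (a : U) : ℝ≥0∞ := ∫⁻ z in S.E, k z ∂(S.Q y a)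

/-- `Q k (y,μ) = ∫∫_E k(z) Q(y,u;dz) μ(du)`. -/
def QMix (k : (Fin n → ℝ) → ℝ≥0∞) (y : Fin n → ℝ) (m : Measure U) : ℝ≥0∞ :=
  ∫⁻ u, S.Qpt k y u ∂m

/-- `λQ k (y,μ) = ∫ λ(y,u) ∫_E k(z) Q(y,u;dz) μ(du)`. -/
def lamQMix (k : (Fin n → ℝ) → ℝ≥0∞) (y : Fin n → ℝ) (m : Measure U) : ℝ≥0∞ :=
  ∫⁻ u, ENNReal.ofReal (S.lam y u) * S.Qpt k y u ∂m

/-- `Λ^μ(x,t) = ∫_0^t λ(φ(x,s), μ(s)) ds`. -/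
def Lam (x : Fin n → ℝ) (Θ : RControl U) (t : ℝ) : ℝ≥0∞ :=
  ∫⁻ s in Set.Ioc (0 : ℝ) t, S.lamMix (S.φ x s) (Θ.time s)

/-- The integrating factor `e^{-α t - Λ^μ(x,t)}` (equal to `0` when `Λ^μ(x,t) = ∞`). -/
def weight (α : ℝ) (x : Fin n → ℝ) (Θ : RControl U) (t : ℝ) : ℝ≥0∞ :=
  if S.Lam x Θ t = ⊤ then 0 else ENNReal.ofReal (Real.exp (-(α * t) - (S.Lam x Θ t).toReal))

/-- `𝓛_α(x,Θ) = ∫_0^{t*(x)} e^{-α s - Λ^μ(x,s)} ds`. -/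
def curlyL (α : ℝ) (x : Fin n → ℝ) (Θ : RControl U) : ℝ≥0∞ :=
  ∫⁻ t in S.fs x, S.weight α x Θ t

/-- `L_α v(x,Θ) = ∫_0^{t*(x)} e^{-α s - Λ^μ(x,s)} v(φ(x,s), μ(s)) ds`. -/
def Lop (α : ℝ) (v : (Fin n → ℝ) → Measure U → ℝ≥0∞) (x : Fin n → ℝ) (Θ : RControl U) :
    ℝ≥0∞ :=
  ∫⁻ t in S.fs x, S.weight α x Θ t * v (S.φ x t) (Θ.time t)

/-- `H_α w(x,Θ) = e^{-α t*(x) - Λ^μ(x,t*(x))} w(φ(x,t*(x)), μ∂)` when `t*(x) < ∞`, else `0`. -/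
def Hop (α : ℝ) (p : (Fin n → ℝ) → Measure U → ℝ≥0∞) (x : Fin n → ℝ) (Θ : RControl U) :
    ℝ≥0∞ :=
  if S.ts x < ⊤ then S.weight α x Θ (S.tsR x) * p (S.φ x (S.tsR x)) Θ.bdry else 0

/-- `G_α k(x,Θ)` for nonnegative `k`. -/
def Gop (α : ℝ) (k : (Fin n → ℝ) → ℝ≥0∞) (x : Fin n → ℝ) (Θ : RControl U) : ℝ≥0∞ :=
  S.Lop α (fun y m => S.lamQMix k y m) x Θ + S.Hop α (fun y m => S.QMix k y m) x Θ

/-- `G_α h(x,Θ)` for signed `h`, as `G_α h⁺ - G_α h⁻` in the extended reals. -/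
def GopS (α : ℝ) (h : (Fin n → ℝ) → ℝ) (x : Fin n → ℝ) (Θ : RControl U) : EReal :=
  ((S.Gop α (fun z => ENNReal.ofReal (h z)) x Θ : ℝ≥0∞) : EReal)
    - ((S.Gop α (fun z => ENNReal.ofReal (-h z)) x Θ : ℝ≥0∞) : EReal)

/-- Admissibility of a relaxed control at `x`, i.e. membership in `V^r(x)`. -/
def IsRelaxed (x : Fin n → ℝ) (Θ : RControl U) : Prop :=
  Measurable Θ.time ∧ (∀ t, IsProbabilityMeasure (Θ.time t)) ∧
    (∀ᵐ t ∂(volume.restrict (S.fs x)), Θ.time t (S.feas (S.φ x t)) = 1) ∧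
    IsProbabilityMeasure Θ.bdry ∧
    (S.ts x < ⊤ → Θ.bdry (S.feas (S.φ x (S.tsR x))) = 1)

/-- The relaxed control `u_φ(x)` induced by a feedback selector `u`. -/
def feedback (u : (Fin n → ℝ) → U) (x : Fin n → ℝ) : RControl U :=
  ⟨fun t => Measure.dirac (u (S.φ x t)), Measure.dirac (u (S.φ x (S.tsR x)))⟩

/-- Ordinary feedback measurable selectors: `u(y) ∈ 𝕌(y)`. -/
def IsSelector (u : (Fin n → ℝ) → U) : Prop :=
  Measurable u ∧ ∀ y ∈ closure S.E, u y ∈ S.feas y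

/-- Membership of `v` in `M^ac(E)` with derivative `Xv` along the flow; boundary values of `v`
are the limits along the flow. -/
def MemMac (v Xv : (Fin n → ℝ) → ℝ) : Prop :=
  Measurable v ∧ Measurable Xv ∧
    (∀ x ∈ S.E, ∀ t ∈ S.fs x,
      IntervalIntegrable (fun s => Xv (S.φ x s)) volume 0 t ∧
        v (S.φ x t) - v x = ∫ s in (0 : ℝ)..t, Xv (S.φ x s)) ∧
    (∀ x ∈ S.E, S.ts x < ⊤ →
      Tendsto (fun t => v (S.φ x t)) (𝓝[<] S.tsR x) (𝓝 (v (S.φ x (S.tsR x)))))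

/-- The weighted supremum norm `‖h‖_g = sup_{x ∈ E} |h(x)|/g(x)`. -/
def gnorm (h g : (Fin n → ℝ) → ℝ) : ℝ := sSup ((fun x => |h x| / g x) '' S.E)

/-- Membership in `B_g(E)`. -/
def memBg (h g : (Fin n → ℝ) → ℝ) : Prop :=
  Measurable h ∧ BddAbove ((fun x => |h x| / g x) '' S.E)

/-- `v(y,μ) = ∫ v(y,u) μ(du)` for a nonnegative cost `v` on `Ē × U`, as a function of the
state and a measure on actions. -/
def mix (_S : Setting n U) (v : (Fin n → ℝ) → U → ℝ) : (Fin n → ℝ) → Measure U → ℝ≥0∞ :=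
  fun y m => ∫⁻ u, ENNReal.ofReal (v y u) ∂m

/-- The quantity `-ρ 𝓛_α(x,Θ) + L_α f(x,Θ) + H_α r(x,Θ) + G_α h(x,Θ)` appearing in the
one-stage optimization problems, valued in the extended reals. -/
def oneStage (α ρ : ℝ) (f r : (Fin n → ℝ) → U → ℝ) (h : (Fin n → ℝ) → ℝ) (x : Fin n → ℝ)
    (Θ : RControl U) : EReal :=
  (-(ρ : EReal)) * ((S.curlyL α x Θ : ℝ≥0∞) : EReal)
    + ((S.Lop α (S.mix f) x Θ : ℝ≥0∞) : EReal)
    + ((S.Hop α (S.mix r) x Θ : ℝ≥0∞) : EReal) + S.GopS α h x Θ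

end Setting

/-- The basic structural assumptions on the data of the control problem. -/
structure Basic [TopologicalSpace U] (S : Setting n U) : Prop where
  openE : IsOpen S.E
  nonemptyE : S.E.Nonempty
  contFlow : Continuous (Function.uncurry S.φ)
  flowZero : ∀ x, S.φ x 0 = x
  flowAdd : ∀ x s t, 0 ≤ s → 0 ≤ t → S.φ x (s + t) = S.φ (S.φ x s) t
  feasCompact : ∀ y ∈ closure S.E, IsCompact (S.feas y)
  feasNonempty : ∀ y ∈ closure S.E, (S.feas y).Nonempty
  lamMeas : Measurable (Function.uncurry S.lam)
  lamNonneg : ∀ y ∈ closure S.E, ∀ u, 0 ≤ S.lam y u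
  Qprob : ∀ y u, IsProbabilityMeasure (S.Q y u)
  QsuppE : ∀ y u, S.Q y u S.E = 1
  Qmeas : Measurable fun p : (Fin n → ℝ) × U => S.Q p.1 p.2

/-- The expected growth condition (Assumption 3.1 of the paper, inequalities (Cu1)/(Cu2)). -/
structure ExpGrowth (S : Setting n U) (b c : ℝ) (g Xg rbar : (Fin n → ℝ) → ℝ) : Prop where
  b_nonneg : 0 ≤ b
  c_pos : 0 < c
  g_ge_one : ∀ y, 1 ≤ g y
  g_mac : S.MemMac g Xg
  rbar_meas : Measurable rbar
  rbar_nonneg : ∀ z ∈ frontier S.E, 0 ≤ rbar z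
  drift : ∀ x ∈ S.E, ∀ a ∈ S.feas x,
    ((Xg x + c * g x : ℝ) : EReal)
        + ((ENNReal.ofReal (S.lam x a) * S.Qpt (fun z => ENNReal.ofReal (g z)) x a : ℝ≥0∞) :
            EReal)
      ≤ ((b + S.lam x a * g x : ℝ) : EReal)
  bdryGrowth : ∀ x ∈ S.E, S.ts x < ⊤ → ∀ a ∈ S.feas (S.φ x (S.tsR x)),
    ENNReal.ofReal (rbar (S.φ x (S.tsR x)))
        + S.Qpt (fun z => ENNReal.ofReal (g z)) (S.φ x (S.tsR x)) a
      ≤ ENNReal.ofReal (g (S.φ x (S.tsR x)))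

/-- The full expected growth condition: the bounds on the running and boundary costs
(inequalities (Cu3)/(Cu3a) of Assumption 3.1 of the paper). -/
structure CostBound (S : Setting n U) (c δ M : ℝ) (g rbar : (Fin n → ℝ) → ℝ)
    (f r : (Fin n → ℝ) → U → ℝ) : Prop where
  δ_pos : 0 < δ
  M_nonneg : 0 ≤ M
  f_meas : Measurable (Function.uncurry f)
  f_nonneg : ∀ y ∈ closure S.E, ∀ u, 0 ≤ f y u
  r_meas : Measurable (Function.uncurry r)
  r_nonneg : ∀ z ∈ frontier S.E, ∀ u, 0 ≤ r z u
  f_bound : ∀ x ∈ S.E, ∀ a ∈ S.feas x, f x a ≤ M * g x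
  r_bound : ∀ x ∈ S.E, S.ts x < ⊤ → ∀ a ∈ S.feas (S.φ x (S.tsR x)),
    r (S.φ x (S.tsR x)) a ≤ M / (c + δ) * rbar (S.φ x (S.tsR x))

/-- The lower-rate condition (parts of Assumptions 3.2 and 3.7 of the paper). -/
structure LowerRate (S : Setting n U) (c : ℝ) (lamL : (Fin n → ℝ) → ℝ) (Kl : ℝ) : Prop where
  lamL_meas : Measurable lamL
  lamL_nonneg : ∀ y, 0 ≤ lamL y
  Kl_nonneg : 0 ≤ Kl
  lam_ge : ∀ y ∈ S.E, ∀ a ∈ S.feas y, lamL y ≤ S.lam y a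
  lamL_locInt : ∀ x ∈ S.E, ∀ t ∈ S.fs x,
    IntervalIntegrable (fun s => lamL (S.φ x s)) volume 0 t
  lamL_intTs : ∀ x ∈ S.E, S.ts x < ⊤ →
    IntervalIntegrable (fun s => lamL (S.φ x s)) volume 0 (S.tsR x)
  intBound : ∀ x ∈ S.E,
    (∫⁻ t in S.fs x,
        ENNReal.ofReal (Real.exp (c * t - ∫ s in (0 : ℝ)..t, lamL (S.φ x s))))
      ≤ ENNReal.ofReal Kl
  supInt : ∀ x ∈ S.E, ∀ t ∈ S.fs x,
    (∫⁻ s in Set.Ioc (0 : ℝ) t, ⨆ a ∈ S.feas (S.φ x s), ENNReal.ofReal (S.lam (S.φ x s) a)) < ⊤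
  supIntTs : ∀ x ∈ S.E, S.ts x < ⊤ →
    (∫⁻ s in Set.Ioc (0 : ℝ) (S.tsR x),
        ⨆ a ∈ S.feas (S.φ x s), ENNReal.ofReal (S.lam (S.φ x s) a)) < ⊤

end

end PDMP

open PDMP MeasureTheory ENNReal Set Filter Topology

lemma aux_comp_ac {f : ℝ → ℝ} {a b : ℝ} (hf : AbsolutelyContinuousOnInterval f a b)
    (h0 : ∀ t ∈ uIcc a b, 0 ≤ f t) :
    AbsolutelyContinuousOnInterval (fun t => Real.exp (-f t)) a b := by
  rw [absolutelyContinuousOnInterval_iff] at hf ⊢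
  intro ε hε
  obtain ⟨δ, hδ, H⟩ := hf ε hε
  refine ⟨δ, hδ, fun E hE hl => lt_of_le_of_lt (Finset.sum_le_sum ?_) (H E hE hl)⟩
  intro i hi
  have key : ∀ p q : ℝ, 0 ≤ p → 0 ≤ q → p ≤ q → |Real.exp (-p) - Real.exp (-q)| ≤ |p - q| := by
    intro p q hp hq hpq
    have h1 : Real.exp (-q) ≤ Real.exp (-p) := Real.exp_le_exp.2 (by linarith)
    rw [abs_of_nonneg (by linarith), abs_of_nonpos (by linarith)]
    have h2 : Real.exp (-q) = Real.exp (-p) * Real.exp (-(q - p)) := by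
      rw [← Real.exp_add]; ring_nf
    have h3 := Real.add_one_le_exp (-(q-p))
    have h4 : Real.exp (-p) ≤ 1 := Real.exp_le_one_iff.2 (by linarith)
    have h5 := Real.exp_pos (-p)
    rw [h2]
    nlinarith [mul_le_mul_of_nonneg_left h3 h5.le]
  have hm := hE.1 i hi
  have hp := h0 _ hm.1
  have hq := h0 _ hm.2
  simp only [Real.dist_eq]
  rcases le_total (f (E.2 i).1) (f (E.2 i).2) with h | h
  · exact key _ _ hp hq h
  · rw [abs_sub_comm, abs_sub_comm (f _)]; exact key _ _ hq hp h

lemma aux_byparts {T : ℝ} (hT : 0 ≤ T) {ℓ X G : ℝ → ℝ}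
    (hℓ : IntervalIntegrable ℓ volume 0 T) (hX : IntervalIntegrable X volume 0 T)
    (hℓ0 : ∀ s, 0 ≤ ℓ s) (hG : ∀ t ∈ Icc 0 T, G t = G 0 + ∫ s in (0:ℝ)..t, X s) :
    IntervalIntegrable
      (fun s => Real.exp (-∫ v in (0:ℝ)..s, ℓ v) * (X s - ℓ s * G s)) volume 0 T ∧
    ∫ s in (0:ℝ)..T, Real.exp (-∫ v in (0:ℝ)..s, ℓ v) * (X s - ℓ s * G s)
      = Real.exp (-∫ v in (0:ℝ)..T, ℓ v) * G T - G 0 := by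
  have hI : uIcc 0 T = Icc 0 T := uIcc_of_le hT
  have hL := hℓ.absolutelyContinuousOnInterval_intervalIntegral (c := 0) (by simp)
  have hX' := hX.absolutelyContinuousOnInterval_intervalIntegral (c := 0) (by simp)
  have hGac : AbsolutelyContinuousOnInterval (fun t => G 0 + ∫ s in (0:ℝ)..t, X s) 0 T := by
    have hc : AbsolutelyContinuousOnInterval (fun _ : ℝ => G 0) 0 T :=
      (contDiff_const.contDiffOn).absolutelyContinuousOnInterval
    exact hc.add hX'
  have hE := aux_comp_ac hL (fun t ht => by
    rw [hI] at ht
    exact intervalIntegral.integral_nonneg ht.1 (fun u _ => hℓ0 u))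
  have hGc : ContinuousOn G (uIcc 0 T) := by
    refine hGac.continuousOn.congr (fun t ht => ?_)
    rw [hI] at ht
    exact hG t ht
  refine ⟨(hX.sub (hℓ.mul_continuousOn hGc)).continuousOn_mul hE.continuousOn, ?_⟩
  have h := hE.integral_deriv_mul_eq_sub hGac
  simp only [intervalIntegral.integral_same, add_zero, neg_zero, Real.exp_zero, one_mul] at h
  rw [← hG T ⟨hT, le_rfl⟩] at h
  rw [← h]
  apply intervalIntegral.integral_congr_ae
  filter_upwards [hℓ.ae_hasDerivAt_integral, hX.ae_hasDerivAt_integral] with t h1 h2 ht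
  have ht' : t ∈ uIcc 0 T := uIoc_subset_uIcc ht
  have d1 := (h1 ht' 0 (by simp)).neg.exp
  have d2 := (h2 ht' 0 (by simp)).const_add (G 0)
  simp only [Pi.neg_apply] at d1
  rw [d1.deriv, d2.deriv, ← hG t (hI ▸ ht')]
  ring

namespace PDMP
variable {n : ℕ} {U : Type*} [MeasurableSpace U]

lemma aux_fs (S : Setting n U) {x : Fin n → ℝ} (hts : S.ts x = ⊤) : S.fs x = Ici 0 := by
  ext t; simp [Setting.fs, hts]

lemma aux_flow_mem [TopologicalSpace U] (S : Setting n U) (hS : Basic S) {x : Fin n → ℝ}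
    (hx : x ∈ S.E) (hts : S.ts x = ⊤) {t : ℝ} (ht : 0 ≤ t) : S.φ x t ∈ S.E := by
  have hnot : ∀ s : ℝ, 0 < s → S.φ x s ∉ frontier S.E := by
    intro s hs hf
    have : S.ts x ≤ ENNReal.ofReal s := sInf_le ⟨s, hs, hf, rfl⟩
    rw [hts] at this
    exact ENNReal.ofReal_ne_top (top_le_iff.1 this)
  have hc : Continuous (S.φ x) := hS.contFlow.comp (by fun_prop : Continuous fun t : ℝ => (x, t))
  have hpre : IsPreconnected (S.φ x '' Icc 0 t) :=
    (isPreconnected_Icc).image _ hc.continuousOn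
  by_contra hcon
  have hsub := hpre.subset_or_subset hS.openE (isClosed_closure (s := S.E)).isOpen_compl
    (Set.disjoint_left.2 fun y hy hy' => hy' (subset_closure hy)) (by
      rintro y ⟨s, hs, rfl⟩
      by_cases hE : S.φ x s ∈ S.E
      · exact Or.inl hE
      · right
        intro hcl
        rcases eq_or_lt_of_le hs.1 with h0 | h0
        · rw [← h0, hS.flowZero] at hE; exact hE hx
        · exact hnot s h0 ⟨hcl, fun hi => hE (interior_subset hi)⟩)
  rcases hsub with h | h
  · exact hcon (h ⟨t, ⟨ht, le_rfl⟩, rfl⟩)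
  · have := h ⟨0, ⟨le_rfl, ht⟩, rfl⟩
    rw [hS.flowZero] at this
    exact this (subset_closure hx)

lemma aux_meas_time {Θ : ℝ → Measure U} (hm : Measurable Θ) (hp : ∀ t, IsProbabilityMeasure (Θ t))
    {F : ℝ → U → ℝ≥0∞} (hF : Measurable (Function.uncurry F)) :
    Measurable fun s => ∫⁻ u, F s u ∂(Θ s) := by
  let κ : ProbabilityTheory.Kernel ℝ U := ⟨Θ, hm⟩
  have : ProbabilityTheory.IsMarkovKernel κ := ⟨hp⟩
  exact Measurable.lintegral_kernel_prod_right (κ := κ) hF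

lemma aux_meas_Qpt [TopologicalSpace U] (S : Setting n U) (hS : Basic S)
    {k : (Fin n → ℝ) → ℝ≥0∞} (hk : Measurable k) :
    Measurable fun p : (Fin n → ℝ) × U => S.Qpt k p.1 p.2 := by
  unfold Setting.Qpt
  simp_rw [← lintegral_indicator hS.openE.measurableSet]
  exact (Measure.measurable_lintegral (hk.indicator hS.openE.measurableSet)).comp hS.Qmeas

lemma aux_ae_feas [MetricSpace U] [BorelSpace U] (S : Setting n U) (hS : Basic S) {x : Fin n → ℝ}
    (hx : x ∈ S.E) (hts : S.ts x = ⊤) {Θ : RControl U} (hΘ : S.IsRelaxed x Θ) :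
    ∀ᵐ s ∂(volume.restrict (Ioi (0:ℝ))),
      S.φ x s ∈ S.E ∧ ∀ᵐ u ∂(Θ.time s), u ∈ S.feas (S.φ x s) := by
  obtain ⟨_, hp, hf, _⟩ := hΘ
  rw [aux_fs S hts] at hf
  have hf' := ae_mono (Measure.restrict_mono Ioi_subset_Ici_self le_rfl) hf
  filter_upwards [hf', ae_restrict_mem measurableSet_Ioi] with s hs hs0
  have hE := aux_flow_mem S hS hx hts (le_of_lt hs0)
  refine ⟨hE, ?_⟩
  have := hp s
  exact (mem_ae_iff_prob_eq_one (hS.feasCompact _ (subset_closure hE)).measurableSet).2 hs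

lemma aux_cont [TopologicalSpace U] (S : Setting n U) (hS : Basic S) (x : Fin n → ℝ) :
    Continuous (S.φ x) :=
  hS.contFlow.comp (by fun_prop : Continuous fun t : ℝ => (x, t))

lemma aux_meas_flow [TopologicalSpace U] (S : Setting n U) (hS : Basic S) (x : Fin n → ℝ) {Θ : RControl U}
    (hΘ : S.IsRelaxed x Θ) {F : (Fin n → ℝ) × U → ℝ≥0∞} (hF : Measurable F) :
    Measurable fun s => ∫⁻ u, F (S.φ x s, u) ∂(Θ.time s) :=
  aux_meas_time (F := fun s u => F (S.φ x s, u)) hΘ.1 hΘ.2.1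
    (hF.comp (((aux_cont S hS x).measurable.comp measurable_fst).prodMk measurable_snd))

lemma aux_Lam [MetricSpace U] [BorelSpace U] (S : Setting n U) (hS : Basic S)
    {c Kl : ℝ} {lamL : (Fin n → ℝ) → ℝ} (hLR : LowerRate S c lamL Kl) {x : Fin n → ℝ}
    (hx : x ∈ S.E) (hts : S.ts x = ⊤) {Θ : RControl U} (hΘ : S.IsRelaxed x Θ) {t : ℝ}
    (ht : 0 ≤ t) :
    S.Lam x Θ t ≠ ⊤ ∧
    IntervalIntegrable (fun s => (S.lamMix (S.φ x s) (Θ.time s)).toReal) volume 0 t ∧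
    (∫ s in (0:ℝ)..t, (S.lamMix (S.φ x s) (Θ.time s)).toReal) = (S.Lam x Θ t).toReal ∧
    (∀ᵐ s ∂(volume.restrict (Ioc 0 t)), S.lamMix (S.φ x s) (Θ.time s) < ⊤) ∧
    (∫ s in (0:ℝ)..t, lamL (S.φ x s)) ≤ (S.Lam x Θ t).toReal := by
  have htf : t ∈ S.fs x := by rw [aux_fs S hts]; exact ht
  have hfe := ae_mono (Measure.restrict_mono (Ioc_subset_Ioi_self : Ioc (0:ℝ) t ⊆ Ioi 0) le_rfl)
    (aux_ae_feas S hS hx hts hΘ)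
  have hm : Measurable fun s => S.lamMix (S.φ x s) (Θ.time s) :=
    aux_meas_flow S hS x hΘ (F := fun p => ENNReal.ofReal (S.lam p.1 p.2))
      hS.lamMeas.ennreal_ofReal
  have hfin : S.Lam x Θ t ≠ ⊤ := by
    refine ((lintegral_mono_ae ?_).trans_lt (hLR.supInt x hx t htf)).ne
    filter_upwards [hfe] with s hs
    have := hΘ.2.1 s
    calc S.lamMix (S.φ x s) (Θ.time s)
        ≤ ∫⁻ _, (⨆ a ∈ S.feas (S.φ x s), ENNReal.ofReal (S.lam (S.φ x s) a)) ∂(Θ.time s) := by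
          refine lintegral_mono_ae ?_
          filter_upwards [hs.2] with u hu
          exact le_iSup₂ (f := fun a _ => ENNReal.ofReal (S.lam (S.φ x s) a)) u hu
      _ = _ := by simp
  have hlt : ∀ᵐ s ∂(volume.restrict (Ioc 0 t)), S.lamMix (S.φ x s) (Θ.time s) < ⊤ :=
    ae_lt_top hm hfin
  have hint : IntervalIntegrable (fun s => (S.lamMix (S.φ x s) (Θ.time s)).toReal) volume 0 t := by
    rw [intervalIntegrable_iff_integrableOn_Ioc_of_le ht]
    exact integrable_toReal_of_lintegral_ne_top hm.aemeasurable hfin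
  have heq : (∫ s in (0:ℝ)..t, (S.lamMix (S.φ x s) (Θ.time s)).toReal) = (S.Lam x Θ t).toReal := by
    rw [intervalIntegral.integral_of_le ht, integral_toReal hm.aemeasurable hlt]; rfl
  refine ⟨hfin, hint, heq, hlt, ?_⟩
  rw [← heq, intervalIntegral.integral_of_le ht, intervalIntegral.integral_of_le ht]
  refine integral_mono_ae ?_ ?_ ?_
  · exact (intervalIntegrable_iff_integrableOn_Ioc_of_le ht).1 (hLR.lamL_locInt x hx t htf)
  · exact (intervalIntegrable_iff_integrableOn_Ioc_of_le ht).1 hint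
  · filter_upwards [hfe, hlt] with s hs hl
    have := hΘ.2.1 s
    rw [← ENNReal.ofReal_le_iff_le_toReal hl.ne]
    calc ENNReal.ofReal (lamL (S.φ x s)) = ∫⁻ _, ENNReal.ofReal (lamL (S.φ x s)) ∂(Θ.time s) := by
          simp
      _ ≤ _ := by
          refine lintegral_mono_ae ?_
          filter_upwards [hs.2] with u hu
          exact ENNReal.ofReal_le_ofReal (hLR.lam_ge _ hs.1 u hu)

lemma aux_weight (S : Setting n U) {x : Fin n → ℝ} {Θ : RControl U} {t α : ℝ}
    (h : S.Lam x Θ t ≠ ⊤) :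
    S.weight α x Θ t = ENNReal.ofReal (Real.exp (-(α * t) - (S.Lam x Θ t).toReal)) := by
  simp [Setting.weight, h]

lemma aux_weight_meas (S : Setting n U) (x : Fin n → ℝ) (Θ : RControl U) (α : ℝ) :
    Measurable (S.weight α x Θ) := by
  have hL : Measurable (S.Lam x Θ) := by
    refine Monotone.measurable fun a b hab => ?_
    exact lintegral_mono_set (Ioc_subset_Ioc_right hab)
  unfold Setting.weight
  refine Measurable.ite (hL (measurableSet_singleton _)) measurable_const ?_
  have := hL.ennreal_toReal
  fun_prop

/-- Pointwise drift inequality averaged over a probability measure on feasible actions. -/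
lemma aux_drift [MetricSpace U] [BorelSpace U] (S : Setting n U) (hS : Basic S)
    {b c : ℝ} {g Xg rbar : (Fin n → ℝ) → ℝ} (hEG : ExpGrowth S b c g Xg rbar)
    {y : Fin n → ℝ} (hy : y ∈ S.E) {m : Measure U} [IsProbabilityMeasure m]
    (hm : ∀ᵐ u ∂m, u ∈ S.feas y) (hl : S.lamMix y m < ⊤) :
    0 ≤ b - Xg y - c * g y + (S.lamMix y m).toReal * g y ∧
    S.lamQMix (fun z => ENNReal.ofReal (g z)) y m ≤
      ENNReal.ofReal (b - Xg y - c * g y + (S.lamMix y m).toReal * g y) := by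
  have hy' := subset_closure hy
  have key : ∀ᵐ u ∂m, 0 ≤ b - Xg y - c * g y + S.lam y u * g y ∧
      ENNReal.ofReal (S.lam y u) * S.Qpt (fun z => ENNReal.ofReal (g z)) y u ≤
        ENNReal.ofReal (b - Xg y - c * g y + S.lam y u * g y) := by
    filter_upwards [hm] with u hu
    have hd := hEG.drift y hy u hu
    set q := ENNReal.ofReal (S.lam y u) * S.Qpt (fun z => ENNReal.ofReal (g z)) y u with hq
    have hqt : q ≠ ⊤ := by
      intro h
      rw [h, EReal.coe_ennreal_top, EReal.coe_add_top] at hd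
      exact absurd (top_le_iff.1 hd) (EReal.coe_ne_top _)
    lift q to NNReal using hqt with q'
    have : (Xg y + c * g y) + (q' : ℝ) ≤ b + S.lam y u * g y := by
      have h2 : (((q' : ℝ≥0∞)) : EReal) = ((q' : ℝ) : EReal) := rfl
      rw [h2, ← EReal.coe_add] at hd
      exact_mod_cast hd
    have h0 := q'.2
    have h1 : (q' : ℝ) ≤ b - Xg y - c * g y + S.lam y u * g y := by linarith
    refine ⟨h0.trans h1, ?_⟩
    rw [← ENNReal.ofReal_coe_nnreal]
    exact ENNReal.ofReal_le_ofReal h1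
  have hlm : Measurable (S.lam y) := hS.lamMeas.comp (measurable_const.prodMk measurable_id)
  have hnn : 0 ≤ᵐ[m] S.lam y := Eventually.of_forall fun u => hS.lamNonneg y hy' u
  have hint : Integrable (S.lam y) m := by
    refine ⟨hlm.aestronglyMeasurable, ?_⟩
    rw [hasFiniteIntegral_iff_ofReal hnn]
    exact hl
  have hI : Integrable (fun u => b - Xg y - c * g y + S.lam y u * g y) m :=
    (integrable_const _).add (hint.mul_const _)
  have heq : ∫ u, (b - Xg y - c * g y + S.lam y u * g y) ∂m
      = b - Xg y - c * g y + (S.lamMix y m).toReal * g y := by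
    rw [integral_add (integrable_const _) (hint.mul_const _), integral_mul_const,
      integral_eq_lintegral_of_nonneg_ae hnn hlm.aestronglyMeasurable]
    simp [Setting.lamMix]
  rw [← heq]
  refine ⟨integral_nonneg_of_ae (key.mono fun u h => h.1), ?_⟩
  rw [ofReal_integral_eq_lintegral_ofReal hI (key.mono fun u h => h.1)]
  exact lintegral_mono_ae (key.mono fun u h => h.2)

lemma aux_weight_le [MetricSpace U] [BorelSpace U] (S : Setting n U) (hS : Basic S)
    {c Kl : ℝ} {lamL : (Fin n → ℝ) → ℝ} (hLR : LowerRate S c lamL Kl) {x : Fin n → ℝ}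
    (hx : x ∈ S.E) (hts : S.ts x = ⊤) {Θ : RControl U} (hΘ : S.IsRelaxed x Θ) {t α : ℝ}
    (ht : 0 ≤ t) (hα : 0 ≤ α) :
    S.weight α x Θ t ≤ ENNReal.ofReal (Real.exp (-∫ s in (0:ℝ)..t, lamL (S.φ x s))) := by
  obtain ⟨h1, -, -, -, h5⟩ := aux_Lam S hS hLR hx hts hΘ ht
  rw [aux_weight S h1]
  refine ENNReal.ofReal_le_ofReal (Real.exp_le_exp.2 ?_)
  have := mul_nonneg hα ht
  linarith

lemma aux_weight_anti [MetricSpace U] [BorelSpace U] (S : Setting n U) (hS : Basic S)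
    {c Kl : ℝ} {lamL : (Fin n → ℝ) → ℝ} (hLR : LowerRate S c lamL Kl) {x : Fin n → ℝ}
    (hx : x ∈ S.E) (hts : S.ts x = ⊤) {Θ : RControl U} (hΘ : S.IsRelaxed x Θ) {t α : ℝ}
    (ht : 0 ≤ t) (hα : 0 ≤ α) :
    S.weight α x Θ t ≤ S.weight 0 x Θ t := by
  obtain ⟨h1, -⟩ := aux_Lam S hS hLR hx hts hΘ ht
  rw [aux_weight S h1, aux_weight S h1]
  refine ENNReal.ofReal_le_ofReal (Real.exp_le_exp.2 ?_)
  have := mul_nonneg hα ht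
  linarith

lemma aux_curlyL [MetricSpace U] [BorelSpace U] (S : Setting n U) (hS : Basic S)
    {c Kl : ℝ} (hc : 0 < c)
    {lamL : (Fin n → ℝ) → ℝ} (hLR : LowerRate S c lamL Kl) {x : Fin n → ℝ}
    (hx : x ∈ S.E) (hts : S.ts x = ⊤) {Θ : RControl U} (hΘ : S.IsRelaxed x Θ) {α : ℝ}
    (hα : 0 ≤ α) :
    S.curlyL α x Θ ≤ ENNReal.ofReal Kl := by
  refine le_trans ?_ (hLR.intBound x hx)
  unfold Setting.curlyL
  rw [aux_fs S hts]
  refine setLIntegral_mono' measurableSet_Ici fun t ht => ?_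
  refine (aux_weight_le S hS hLR hx hts hΘ ht hα).trans ?_
  refine ENNReal.ofReal_le_ofReal (Real.exp_le_exp.2 ?_)
  have := mul_nonneg hc.le (mem_Ici.1 ht)
  linarith

lemma aux_LamQ_T [MetricSpace U] [BorelSpace U] (S : Setting n U) (hS : Basic S)
    {b c Kl : ℝ} {g Xg rbar lamL : (Fin n → ℝ) → ℝ} (hEG : ExpGrowth S b c g Xg rbar)
    (hLR : LowerRate S c lamL Kl) {x : Fin n → ℝ}
    (hx : x ∈ S.E) (hts : S.ts x = ⊤) {Θ : RControl U} (hΘ : S.IsRelaxed x Θ) {T : ℝ}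
    (hT : 0 ≤ T) :
    ∫⁻ s in Ioc 0 T, S.weight 0 x Θ s *
        S.lamQMix (fun z => ENNReal.ofReal (g z)) (S.φ x s) (Θ.time s)
      ≤ ENNReal.ofReal (b * Kl + g x) := by
  have hfe := ae_mono (Measure.restrict_mono (Ioc_subset_Ioi_self : Ioc (0:ℝ) T ⊆ Ioi 0) le_rfl)
    (aux_ae_feas S hS hx hts hΘ)
  obtain ⟨-, hℓ, -, hlt, -⟩ := aux_Lam S hS hLR hx hts hΘ hT
  set ℓ : ℝ → ℝ := fun s => (S.lamMix (S.φ x s) (Θ.time s)).toReal with hℓdef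
  have hw : ∀ t, 0 ≤ t → S.weight 0 x Θ t = ENNReal.ofReal (Real.exp (-∫ v in (0:ℝ)..t, ℓ v)) := by
    intro t ht
    obtain ⟨h1, -, h3, -⟩ := aux_Lam S hS hLR hx hts hΘ ht
    rw [aux_weight S h1, h3]; simp
  have hmac := hEG.g_mac.2.2.1 x hx
  have hfs : ∀ t, 0 ≤ t → t ∈ S.fs x := fun t ht => by rw [aux_fs S hts]; exact ht
  obtain ⟨hbi, hbe⟩ := aux_byparts hT hℓ (hmac T (hfs T hT)).1 (G := fun t => g (S.φ x t))
    (fun s => ENNReal.toReal_nonneg) (fun t ht => by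
      have := (hmac t (hfs t ht.1)).2
      simp only [hS.flowZero]
      linarith)
  simp only [hS.flowZero] at hbe
  have hEc : ContinuousOn (fun t => Real.exp (-∫ v in (0:ℝ)..t, ℓ v)) (uIcc 0 T) := by
    have := (hℓ.absolutelyContinuousOnInterval_intervalIntegral (c := 0) (by simp)).continuousOn
    exact this.neg.rexp
  have hEi : IntervalIntegrable (fun t => Real.exp (-∫ v in (0:ℝ)..t, ℓ v)) volume 0 T :=
    hEc.intervalIntegrable
  set e : ℝ → ℝ := fun t => Real.exp (-∫ v in (0:ℝ)..t, ℓ v) with he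
  have hEK : ∫ t in (0:ℝ)..T, e t ≤ Kl := by
    rw [← ENNReal.ofReal_le_ofReal_iff hLR.Kl_nonneg, intervalIntegral.integral_of_le hT,
      ofReal_integral_eq_lintegral_ofReal
        ((intervalIntegrable_iff_integrableOn_Ioc_of_le hT).1 hEi)
        (Eventually.of_forall fun t => (Real.exp_pos _).le)]
    refine le_trans ?_ (aux_curlyL S hS hEG.c_pos hLR hx hts hΘ le_rfl)
    unfold Setting.curlyL
    rw [aux_fs S hts]
    calc _ = ∫⁻ t in Ioc 0 T, S.weight 0 x Θ t :=
          setLIntegral_congr_fun measurableSet_Ioc fun t ht => (hw t ht.1.le).symm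
      _ ≤ _ := lintegral_mono_set (Ioc_subset_Icc_self.trans Icc_subset_Ici_self)
  have hpt : ∀ᵐ s ∂(volume.restrict (Ioc 0 T)),
      0 ≤ e s * b - e s * (Xg (S.φ x s) - ℓ s * g (S.φ x s)) ∧
      S.weight 0 x Θ s * S.lamQMix (fun z => ENNReal.ofReal (g z)) (S.φ x s) (Θ.time s) ≤
      ENNReal.ofReal (e s * b - e s * (Xg (S.φ x s) - ℓ s * g (S.φ x s))) := by
    filter_upwards [hfe, hlt, ae_restrict_mem measurableSet_Ioc] with s hs hl hsm
    have := hΘ.2.1 s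
    obtain ⟨d1, d2⟩ := aux_drift S hS hEG hs.1 hs.2 hl
    have hcg : 0 ≤ c * g (S.φ x s) :=
      mul_nonneg hEG.c_pos.le (zero_le_one.trans (hEG.g_ge_one _))
    have he0 : 0 ≤ e s := (Real.exp_pos _).le
    have hr : e s * (b - Xg (S.φ x s) - c * g (S.φ x s) + ℓ s * g (S.φ x s)) ≤
        e s * b - e s * (Xg (S.φ x s) - ℓ s * g (S.φ x s)) := by
      nlinarith [mul_nonneg he0 hcg]
    refine ⟨(mul_nonneg he0 d1).trans hr, ?_⟩
    rw [hw s hsm.1.le]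
    refine (mul_le_mul_right d2 _).trans ?_
    rw [← ENNReal.ofReal_mul he0]
    exact ENNReal.ofReal_le_ofReal hr
  refine (lintegral_mono_ae (hpt.mono fun s h => h.2)).trans ?_
  have hI := (hEi.mul_const b).sub hbi
  rw [← ofReal_integral_eq_lintegral_ofReal
    ((intervalIntegrable_iff_integrableOn_Ioc_of_le hT).1 hI) (hpt.mono fun s h => h.1)]
  refine ENNReal.ofReal_le_ofReal ?_
  rw [← intervalIntegral.integral_of_le hT, intervalIntegral.integral_sub (hEi.mul_const b) hbi,
    hbe, intervalIntegral.integral_mul_const]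
  have h1 := mul_le_mul_of_nonneg_right hEK hEG.b_nonneg
  have h2 : 0 ≤ e T * g (S.φ x T) :=
    mul_nonneg (Real.exp_pos _).le (zero_le_one.trans (hEG.g_ge_one _))
  simp only [he] at h1 h2 ⊢
  linarith

lemma aux_lamQ_meas [TopologicalSpace U] (S : Setting n U) (hS : Basic S) (x : Fin n → ℝ)
    {Θ : RControl U} (hΘ : S.IsRelaxed x Θ) {k : (Fin n → ℝ) → ℝ≥0∞} (hk : Measurable k) :
    Measurable fun s => S.lamQMix k (S.φ x s) (Θ.time s) :=
  aux_meas_flow S hS x hΘ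
    (F := fun p => ENNReal.ofReal (S.lam p.1 p.2) * S.Qpt k p.1 p.2)
    (hS.lamMeas.ennreal_ofReal.mul (aux_meas_Qpt S hS hk))

lemma aux_LamQ [MetricSpace U] [BorelSpace U] (S : Setting n U) (hS : Basic S)
    {b c Kl : ℝ} {g Xg rbar lamL : (Fin n → ℝ) → ℝ} (hEG : ExpGrowth S b c g Xg rbar)
    (hLR : LowerRate S c lamL Kl) {x : Fin n → ℝ}
    (hx : x ∈ S.E) (hts : S.ts x = ⊤) {Θ : RControl U} (hΘ : S.IsRelaxed x Θ) :
    ∫⁻ s in Ioi 0, S.weight 0 x Θ s *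
        S.lamQMix (fun z => ENNReal.ofReal (g z)) (S.φ x s) (Θ.time s)
      ≤ ENNReal.ofReal (b * Kl + g x) := by
  have hm : Measurable fun s => S.weight 0 x Θ s *
        S.lamQMix (fun z => ENNReal.ofReal (g z)) (S.φ x s) (Θ.time s) :=
    (aux_weight_meas S x Θ 0).mul (aux_lamQ_meas S hS x hΘ hEG.g_mac.1.ennreal_ofReal)
  have hcov : AECover (volume.restrict (Ioi (0:ℝ))) atTop (fun T : ℝ => Iic T) :=
    (aecover_Iic tendsto_id).restrict
  refine le_of_tendsto (hcov.lintegral_tendsto_of_countably_generated hm.aemeasurable) ?_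
  filter_upwards [eventually_ge_atTop 0] with T hT
  rw [Measure.restrict_restrict measurableSet_Iic, inter_comm, Ioi_inter_Iic]
  exact aux_LamQ_T S hS hEG hLR hx hts hΘ hT

/-- Finiteness of the jump term for `k` dominated by a multiple of `g` on `E`. -/
lemma aux_LamQ_k [MetricSpace U] [BorelSpace U] (S : Setting n U) (hS : Basic S)
    {b c Kl : ℝ} {g Xg rbar lamL : (Fin n → ℝ) → ℝ} (hEG : ExpGrowth S b c g Xg rbar)
    (hLR : LowerRate S c lamL Kl) {x : Fin n → ℝ}
    (hx : x ∈ S.E) (hts : S.ts x = ⊤) {Θ : RControl U} (hΘ : S.IsRelaxed x Θ)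
    {α : ℝ} (hα : 0 ≤ α) {k : (Fin n → ℝ) → ℝ≥0∞} {C : ℝ}
    (hk : ∀ z ∈ S.E, k z ≤ ENNReal.ofReal C * ENNReal.ofReal (g z)) :
    ∫⁻ s in Ioi 0, S.weight α x Θ s * S.lamQMix k (S.φ x s) (Θ.time s) ≠ ⊤ := by
  have hgm := hEG.g_mac.1.ennreal_ofReal
  have hpt : ∀ y m, S.lamQMix k y m ≤
      ENNReal.ofReal C * S.lamQMix (fun z => ENNReal.ofReal (g z)) y m := by
    intro y m
    unfold Setting.lamQMix
    rw [← lintegral_const_mul' _ _ ENNReal.ofReal_ne_top]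
    refine lintegral_mono fun u => ?_
    have : S.Qpt k y u ≤ ENNReal.ofReal C * S.Qpt (fun z => ENNReal.ofReal (g z)) y u := by
      unfold Setting.Qpt
      rw [← lintegral_const_mul' _ _ ENNReal.ofReal_ne_top]
      exact setLIntegral_mono' hS.openE.measurableSet hk
    refine (mul_le_mul_right this _).trans (le_of_eq ?_)
    ring
  refine ne_top_of_le_ne_top (ENNReal.mul_ne_top (ENNReal.ofReal_ne_top (r := C))
    (ne_top_of_le_ne_top ENNReal.ofReal_ne_top (aux_LamQ S hS hEG hLR hx hts hΘ))) ?_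
  rw [← lintegral_const_mul' _ _ ENNReal.ofReal_ne_top]
  refine setLIntegral_mono' measurableSet_Ioi fun s hs => ?_
  refine (mul_le_mul' (aux_weight_anti S hS hLR hx hts hΘ (le_of_lt hs) hα) (hpt _ _)).trans
    (le_of_eq ?_)
  ring

lemma aux_Lf [MetricSpace U] [BorelSpace U] (S : Setting n U) (hS : Basic S)
    {c Kl : ℝ} {lamL : (Fin n → ℝ) → ℝ}
    (hLR : LowerRate S c lamL Kl) {x : Fin n → ℝ}
    (hx : x ∈ S.E) (hts : S.ts x = ⊤) {Θ : RControl U} (hΘ : S.IsRelaxed x Θ)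
    {α : ℝ} (hα : 0 ≤ α) {f : (Fin n → ℝ) → U → ℝ} {fbar : (Fin n → ℝ) → ℝ}
    (hf_le : ∀ y ∈ S.E, ∀ a ∈ S.feas y, f y a ≤ fbar y)
    (hfbar_int : ∀ x ∈ S.E,
      (∫⁻ t in S.fs x,
          ENNReal.ofReal (Real.exp (-∫ s in (0:ℝ)..t, lamL (S.φ x s)))
            * ENNReal.ofReal (fbar (S.φ x t))) < ⊤) :
    ∫⁻ s in Ioi 0, S.weight α x Θ s * S.mix f (S.φ x s) (Θ.time s) ≠ ⊤ := by
  have h := hfbar_int x hx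
  rw [aux_fs S hts] at h
  refine ((lintegral_mono_ae ?_).trans_lt
    ((lintegral_mono_set Ioi_subset_Ici_self).trans_lt h)).ne
  filter_upwards [aux_ae_feas S hS hx hts hΘ, ae_restrict_mem measurableSet_Ioi] with s hs h0
  refine mul_le_mul' (aux_weight_le S hS hLR hx hts hΘ (le_of_lt h0) hα) ?_
  have := hΘ.2.1 s
  calc S.mix f (S.φ x s) (Θ.time s)
      ≤ ∫⁻ _, ENNReal.ofReal (fbar (S.φ x s)) ∂(Θ.time s) := by
        refine lintegral_mono_ae ?_
        filter_upwards [hs.2] with u hu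
        exact ENNReal.ofReal_le_ofReal (hf_le _ hs.1 u hu)
    _ = _ := by simp

lemma aux_toReal_int {w A : ℝ → ℝ≥0∞} (hw : Measurable w) (hA : Measurable A)
    (h : ∫⁻ s in Ioi (0:ℝ), w s * A s ≠ ⊤) :
    IntegrableOn (fun s => (w s).toReal * (A s).toReal) (Ioi 0) ∧
    ∫ s in Ioi (0:ℝ), (w s).toReal * (A s).toReal = (∫⁻ s in Ioi (0:ℝ), w s * A s).toReal := by
  simp_rw [← ENNReal.toReal_mul]
  have hm : Measurable fun s => w s * A s := hw.mul hA
  exact ⟨integrable_toReal_of_lintegral_ne_top hm.aemeasurable h,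
    integral_toReal hm.aemeasurable (ae_lt_top hm h)⟩

lemma aux_int4 {μ : Measure ℝ} {ρ : ℝ} {A B C D : ℝ → ℝ} (hA : Integrable A μ)
    (hB : Integrable B μ) (hC : Integrable C μ) (hD : Integrable D μ) :
    ∫ s, (-ρ * A s + B s + C s - D s) ∂μ =
      -ρ * (∫ s, A s ∂μ) + (∫ s, B s ∂μ) + (∫ s, C s ∂μ) - ∫ s, D s ∂μ := by
  have h1 : Integrable (fun s => -ρ * A s) μ := hA.const_mul (-ρ)
  have h2 : Integrable (fun s => -ρ * A s + B s) μ := h1.add hB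
  have h3 : Integrable (fun s => -ρ * A s + B s + C s) μ := h2.add hC
  rw [integral_sub h3 hD, integral_add h2 hC, integral_add h1 hB, integral_const_mul]

end PDMP

/-- Identity (lim) of Lemma 3.13 of the paper: under the expected growth, lower-rate and
running-cost domination conditions, for `x` with `t*(x) = ∞` and `Θ ∈ V^r(x)`, the limit
`lim_{t→∞} ∫_0^t e^{-αs-Λ^μ(x,s)}[-ρ + f(φ(x,s),μ(s)) + λQh(φ(x,s),μ(s))] ds` exists in `ℝ`
and equals `-ρ𝓛_α(x,Θ) + L_α f(x,Θ) + H_α r(x,Θ) + G_α h(x,Θ)`. -/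
theorem lemma_3_13_lim {n : ℕ} {U : Type*} [MeasurableSpace U] [MetricSpace U]
    [CompactSpace U] [BorelSpace U]
    (S : Setting n U) (hS : Basic S)
    (b c : ℝ) (g Xg rbar lamL : (Fin n → ℝ) → ℝ) (Kl : ℝ)
    (hEG : ExpGrowth S b c g Xg rbar) (hLR : LowerRate S c lamL Kl)
    (f r : (Fin n → ℝ) → U → ℝ)
    (hf_meas : Measurable (Function.uncurry f)) (hf_nonneg : ∀ y ∈ closure S.E, ∀ a, 0 ≤ f y a)
    (hr_meas : Measurable (Function.uncurry r)) (hr_nonneg : ∀ z ∈ frontier S.E, ∀ a, 0 ≤ r z a)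
    -- domination of the running cost: `f ≤ f̄` with
    -- `∫_0^{t*(x)} e^{-∫_0^t λ̲(φ(x,s))ds} f̄(φ(x,t)) dt < ∞`
    (fbar : (Fin n → ℝ) → ℝ) (hfbar_meas : Measurable fbar) (hfbar_nonneg : ∀ y, 0 ≤ fbar y)
    (hf_le : ∀ y ∈ S.E, ∀ a ∈ S.feas y, f y a ≤ fbar y)
    (hfbar_int : ∀ x ∈ S.E,
      (∫⁻ t in S.fs x,
          ENNReal.ofReal (Real.exp (-∫ s in (0:ℝ)..t, lamL (S.φ x s)))
            * ENNReal.ofReal (fbar (S.φ x t))) < ⊤)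
    (α ρ : ℝ) (hα : 0 ≤ α) (hρ : 0 ≤ ρ)
    (h : (Fin n → ℝ) → ℝ) (hh : S.memBg h g)
    (x : Fin n → ℝ) (hx : x ∈ S.E) (hts : S.ts x = ⊤)
    (Θ : RControl U) (hΘ : S.IsRelaxed x Θ) :
    ∃ l : ℝ,
      Tendsto (fun t : ℝ => ∫ s in Set.Ioc (0:ℝ) t,
          (S.weight α x Θ s).toReal *
            (-ρ + (∫ u, f (S.φ x s) u ∂(Θ.time s))
              + ((S.lamQMix (fun z => ENNReal.ofReal (h z)) (S.φ x s) (Θ.time s)).toReal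
                - (S.lamQMix (fun z => ENNReal.ofReal (-h z)) (S.φ x s) (Θ.time s)).toReal)))
        atTop (𝓝 l) ∧
      (l : EReal) = S.oneStage α ρ f r h x Θ := by
  have hIci : ∀ F : ℝ → ℝ≥0∞, ∫⁻ s in S.fs x, F s = ∫⁻ s in Ioi (0:ℝ), F s := fun F => by
    rw [aux_fs S hts]
    exact setLIntegral_congr Ioi_ae_eq_Ici.symm
  have hwm := aux_weight_meas S x Θ α
  have hfm : Measurable fun s => S.mix f (S.φ x s) (Θ.time s) :=
    aux_meas_flow S hS x hΘ (F := fun p => ENNReal.ofReal (f p.1 p.2)) hf_meas.ennreal_ofReal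
  have hpm := aux_lamQ_meas S hS x hΘ (k := fun z => ENNReal.ofReal (h z)) hh.1.ennreal_ofReal
  have hnm := aux_lamQ_meas S hS x hΘ (k := fun z => ENNReal.ofReal (-h z))
    hh.1.neg.ennreal_ofReal
  obtain ⟨C, hC⟩ := hh.2
  have hCg : ∀ z ∈ S.E, |h z| ≤ C * g z := fun z hz => by
    have h1 := hC ⟨z, hz, rfl⟩
    exact (div_le_iff₀ (zero_lt_one.trans_le (hEG.g_ge_one z))).1 h1
  have hb : ∀ v : (Fin n → ℝ) → ℝ, (∀ z, v z ≤ |h z|) → ∀ z ∈ S.E,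
      ENNReal.ofReal (v z) ≤ ENNReal.ofReal C * ENNReal.ofReal (g z) := fun v hv z hz => by
    rw [← ENNReal.ofReal_mul' (zero_le_one.trans (hEG.g_ge_one z))]
    exact ENNReal.ofReal_le_ofReal ((hv z).trans (hCg z hz))
  have hPfin := aux_LamQ_k S hS hEG hLR hx hts hΘ hα (hb h fun z => le_abs_self _)
  have hNfin := aux_LamQ_k S hS hEG hLR hx hts hΘ hα (hb (fun z => -h z) fun z => neg_le_abs _)
  have hFfin := aux_Lf S hS hLR hx hts hΘ hα hf_le hfbar_int
  have hWfin : ∫⁻ s in Ioi (0:ℝ), S.weight α x Θ s * 1 ≠ ⊤ := by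
    simp only [mul_one]
    rw [← hIci]
    exact ne_top_of_le_ne_top ENNReal.ofReal_ne_top
      (aux_curlyL S hS hEG.c_pos hLR hx hts hΘ hα)
  obtain ⟨iW, eW⟩ := aux_toReal_int hwm measurable_const hWfin
  obtain ⟨iF, eF⟩ := aux_toReal_int hwm hfm hFfin
  obtain ⟨iP, eP⟩ := aux_toReal_int hwm hpm hPfin
  obtain ⟨iN, eN⟩ := aux_toReal_int hwm hnm hNfin
  simp only [ENNReal.toReal_one, mul_one] at iW eW hWfin
  set w : ℝ → ℝ := fun s => (S.weight α x Θ s).toReal with hw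
  set F : ℝ → ℝ := fun s => (S.mix f (S.φ x s) (Θ.time s)).toReal with hF
  set P : ℝ → ℝ := fun s =>
    (S.lamQMix (fun z => ENNReal.ofReal (h z)) (S.φ x s) (Θ.time s)).toReal with hP
  set N : ℝ → ℝ := fun s =>
    (S.lamQMix (fun z => ENNReal.ofReal (-h z)) (S.φ x s) (Θ.time s)).toReal with hN
  have hfF : ∀ s ∈ Ioi (0:ℝ), ∫ u, f (S.φ x s) u ∂(Θ.time s) = F s := by
    intro s hs
    have hE := aux_flow_mem S hS hx hts (le_of_lt hs)
    have hm : Measurable (f (S.φ x s)) := hf_meas.comp (measurable_const.prodMk measurable_id)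
    rw [integral_eq_lintegral_of_nonneg_ae
      (Eventually.of_forall fun u => hf_nonneg _ (subset_closure hE) u) hm.aestronglyMeasurable]
    rfl
  have hint : IntegrableOn (fun s => -ρ * w s + w s * F s + w s * P s - w s * N s) (Ioi 0) :=
    (((iW.const_mul (-ρ)).add iF).add iP).sub iN
  have heq : ∫ s in Ioi (0:ℝ), (-ρ * w s + w s * F s + w s * P s - w s * N s) =
      -ρ * (∫ s in Ioi (0:ℝ), w s) + (∫ s in Ioi (0:ℝ), w s * F s)
        + (∫ s in Ioi (0:ℝ), w s * P s) - ∫ s in Ioi (0:ℝ), w s * N s := by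
    exact aux_int4 iW iF iP iN
  refine ⟨∫ s in Ioi (0:ℝ), (-ρ * w s + w s * F s + w s * P s - w s * N s), ?_, ?_⟩
  · refine (intervalIntegral_tendsto_integral_Ioi 0 hint tendsto_id).congr' ?_
    filter_upwards [eventually_ge_atTop 0] with t ht
    simp only [id]
    rw [intervalIntegral.integral_of_le ht]
    refine setIntegral_congr_fun measurableSet_Ioc fun s hs => ?_
    beta_reduce
    rw [hfF s hs.1]
    ring
  · rw [heq, eW, eF, eP, eN]
    have hH : ∀ p, S.Hop α p x Θ = 0 := fun p => by simp [Setting.Hop, hts]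
    unfold Setting.oneStage Setting.GopS Setting.Gop
    simp only [hH, add_zero, EReal.coe_ennreal_zero]
    unfold Setting.curlyL Setting.Lop
    simp only [hIci]
    rw [← EReal.coe_ennreal_toReal hWfin, ← EReal.coe_ennreal_toReal hFfin,
      ← EReal.coe_ennreal_toReal hPfin, ← EReal.coe_ennreal_toReal hNfin]
    norm_cast
    congr 1
    ring
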